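/- Let D be a standard Borel space and let m : D × D → [0,1] be measurable with respect to the product σ-algebra and satisfy the triangle inequality m(d₁,d₂) ≤ m(d₁,d₃) + m(d₃,d₂) for all d₁, d₂, d₃ ∈ D. Then the Wasserstein lifting satisfies the triangle inequality: for all probability measures μ, ν, κ on D, W(m)(μ,κ) ≤ W(m)(μ,ν) + W(m)(ν,κ). -/

import Mathlib

open MeasureTheory

/-- The set of couplings of `μ` and `ν`: probability measures on `D × D`
with marginals `μ` and `ν`. -/
def couplings {D : Type*} [MeasurableSpace D] (μ ν : Measure D) :
    Set (Measure (D × D)) :=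
  {w | IsProbabilityMeasure w ∧ w.map Prod.fst = μ ∧ w.map Prod.snd = ν}

/-- The Wasserstein lifting of a cost `m` to a distance between measures:
the infimum over couplings `w` of `μ` and `ν` of `∫ m dw`. -/
noncomputable def wass {D : Type*} [MeasurableSpace D] (m : D × D → ℝ)
    (μ ν : Measure D) : ℝ :=
  sInf ((fun w => ∫ x, m x ∂w) '' couplings μ ν)

open ProbabilityTheory in
/-- Gluing lemma: two couplings sharing the marginal `ν` are the projections of a single
measure on the triple product. -/
theorem exists_gluing {D : Type*} [MeasurableSpace D] [StandardBorelSpace D]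
    {μ ν κ : Measure D} {w₁ w₂ : Measure (D × D)}
    (h₁ : w₁ ∈ couplings μ ν) (h₂ : w₂ ∈ couplings ν κ) :
    ∃ γ : Measure ((D × D) × D), IsProbabilityMeasure γ ∧ γ.map Prod.fst = w₁ ∧
      γ.map (fun p => (p.1.2, p.2)) = w₂ := by
  obtain ⟨_, -, hw₁⟩ := h₁
  obtain ⟨_, hw₂, -⟩ := h₂
  have : Nonempty D := (nonempty_of_isProbabilityMeasure w₁).map Prod.fst
  refine ⟨w₁ ⊗ₘ (w₂.condKernel.comap Prod.snd measurable_snd), inferInstance,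
    Measure.fst_compProd _ _, ?_⟩
  have hfst : w₁.map Prod.snd = w₂.fst := hw₁.trans hw₂.symm
  have hmeas : Measurable fun p : (D × D) × D => (p.1.2, p.2) := by fun_prop
  conv_rhs => rw [← w₂.disintegrate w₂.condKernel, ← hfst]
  ext s hs
  rw [Measure.map_apply hmeas hs, Measure.compProd_apply (hmeas hs), Measure.compProd_apply hs,
    lintegral_map (Kernel.measurable_kernel_prodMk_left hs) measurable_snd]
  rfl

/-- The integral of the cost against any coupling bounds the Wasserstein lifting. -/
theorem wass_le_integral {D : Type*} [MeasurableSpace D] {m : D × D → ℝ} (hm : ∀ x, 0 ≤ m x)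
    {μ ν : Measure D} {w : Measure (D × D)} (hw : w ∈ couplings μ ν) :
    wass m μ ν ≤ ∫ x, m x ∂w :=
  csInf_le ⟨0, by rintro _ ⟨w, -, rfl⟩; exact integral_nonneg hm⟩ ⟨w, hw, rfl⟩

/-- The product measure is a coupling. -/
theorem couplings_nonempty {D : Type*} [MeasurableSpace D] (μ ν : Measure D)
    [IsProbabilityMeasure μ] [IsProbabilityMeasure ν] : (couplings μ ν).Nonempty :=
  ⟨μ.prod ν, inferInstance, Measure.fst_prod, Measure.snd_prod⟩

/-- on a standard Borel space, if the measurable cost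
`m : D × D → [0,1]` satisfies the triangle inequality, then so does its
Wasserstein lifting: `W(m)(μ,κ) ≤ W(m)(μ,ν) + W(m)(ν,κ)` for all probability
measures `μ, ν, κ`. -/
theorem wass_triangle {D : Type*} [MeasurableSpace D] [StandardBorelSpace D]
    (m : D × D → ℝ) (hm : Measurable m) (hm01 : ∀ x, m x ∈ Set.Icc (0 : ℝ) 1)
    (htri : ∀ d₁ d₂ d₃ : D, m (d₁, d₂) ≤ m (d₁, d₃) + m (d₃, d₂))
    (μ ν κ : Measure D) [IsProbabilityMeasure μ] [IsProbabilityMeasure ν]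
    [IsProbabilityMeasure κ] :
    wass m μ κ ≤ wass m μ ν + wass m ν κ := by
  have key : ∀ w₁ ∈ couplings μ ν, ∀ w₂ ∈ couplings ν κ,
      wass m μ κ ≤ ∫ x, m x ∂w₁ + ∫ x, m x ∂w₂ := by
    intro w₁ h₁ w₂ h₂
    obtain ⟨γ, _, hγ₁, hγ₂⟩ := exists_gluing h₁ h₂
    have hout : Measurable fun p : (D × D) × D => (p.1.1, p.2) := by fun_prop
    have hright : Measurable fun p : (D × D) × D => (p.1.2, p.2) := by fun_prop
    have hcoupling : γ.map (fun p => (p.1.1, p.2)) ∈ couplings μ κ := by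
      refine ⟨Measure.isProbabilityMeasure_map hout.aemeasurable, ?_, ?_⟩
      · rw [← h₁.2.1, ← hγ₁, Measure.map_map measurable_fst hout,
          Measure.map_map measurable_fst measurable_fst]
        rfl
      · rw [← h₂.2.2, ← hγ₂, Measure.map_map measurable_snd hout,
          Measure.map_map measurable_snd hright]
        rfl
    have hint : ∀ f : (D × D) × D → D × D, Measurable f → Integrable (fun p => m (f p)) γ :=
      fun f hf => Integrable.of_mem_Icc 0 1 (hm.comp hf).aemeasurable
        (Filter.Eventually.of_forall fun p => hm01 (f p))
    calc wass m μ κ ≤ ∫ x, m x ∂(γ.map fun p => (p.1.1, p.2)) :=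
          wass_le_integral (fun x => (hm01 x).1) hcoupling
      _ = ∫ p, m (p.1.1, p.2) ∂γ :=
          integral_map hout.aemeasurable hm.aestronglyMeasurable
      _ ≤ ∫ p, (m p.1 + m (p.1.2, p.2)) ∂γ :=
          integral_mono (hint _ hout) ((hint _ measurable_fst).add (hint _ hright))
            fun p => htri p.1.1 p.2 p.1.2
      _ = ∫ p, m p.1 ∂γ + ∫ p, m (p.1.2, p.2) ∂γ :=
          integral_add (hint _ measurable_fst) (hint _ hright)
      _ = ∫ x, m x ∂w₁ + ∫ x, m x ∂w₂ := by
          rw [← hγ₁, ← hγ₂, integral_map measurable_fst.aemeasurable hm.aestronglyMeasurable,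
            integral_map hright.aemeasurable hm.aestronglyMeasurable]
  rw [← sub_le_iff_le_add]
  refine le_csInf ((couplings_nonempty μ ν).image _) ?_
  rintro _ ⟨w₁, h₁, rfl⟩
  rw [sub_le_comm]
  refine le_csInf ((couplings_nonempty ν κ).image _) ?_
  rintro _ ⟨w₂, h₂, rfl⟩
  exact sub_le_iff_le_add'.2 (key w₁ h₁ w₂ h₂)
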